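/- Let m = m₁ + m₂ and let G‴ be the graph obtained from G(L⁽¹⁾,x,y,l,m) by replacing the copies Lᵢ for i = m₁+1, …, m−1 with copies of L⁽²⁾ and replacing the copy Lₘ with a copy of L⁽³⁾ (with their distinguished vertices x, y playing the roles of xᵢ, yᵢ). For all integers l ≥ 2, m ≥ 1 and m₂ ≥ l − 2, the toughness of G‴ equals (l + 3m₂ + 1)/(2(m₂ + 1)). -/

import Mathlib

open SimpleGraph

/-- Number of connected components of the subgraph induced on the complement of `S`. -/
noncomputable def numComponents {V : Type} (G : SimpleGraph V) (S : Set V) : ℕ :=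
  Nat.card (G.induce Sᶜ).ConnectedComponent

/-- `G` is `t`-tough: `|S| ≥ t · ω(G \ S)` for every vertex subset `S`
with `ω(G \ S) > 1`. -/
def IsTough {V : Type} (t : ℝ) (G : SimpleGraph V) : Prop :=
  ∀ S : Finset V, 1 < numComponents G ↑S →
    t * (numComponents G ↑S : ℝ) ≤ (S.card : ℝ)

/-- The toughness of `G` equals `t`: `t` is the greatest nonnegative real
for which `G` is `t`-tough. -/
def HasToughness {V : Type} (G : SimpleGraph V) (t : ℝ) : Prop :=
  IsGreatest {s : ℝ | 0 ≤ s ∧ IsTough s G} t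

/-- A Hamiltonian cycle: a cycle whose support contains every vertex. -/
def IsHamCycle {V : Type} {G : SimpleGraph V} {v : V} (p : G.Walk v v) : Prop :=
  p.IsCycle ∧ ∀ u, u ∈ p.support

/-- A graph is Hamiltonian if it contains a Hamiltonian cycle. -/
def IsHam {V : Type} (G : SimpleGraph V) : Prop :=
  ∃ (v : V) (p : G.Walk v v), IsHamCycle p

/-- `x` and `y` are connected by a Hamilton path of `G`: a path with endpoints
`x` and `y` containing every vertex of `G`. -/
def HamConnected {V : Type} (G : SimpleGraph V) (x y : V) : Prop :=
  ∃ p : G.Walk x y, p.IsPath ∧ ∀ v, v ∈ p.support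

/-- `L⁽¹⁾`: the 8-cycle `w₁w₂…w₈w₁` (here `wᵢ = i - 1`) together with the
edges `w₂w₄, w₄w₆, w₆w₈, w₂w₈`; `x = w₁ = 0`, `y = w₅ = 4`. -/
def L1 : SimpleGraph (Fin 8) := SimpleGraph.fromEdgeSet
  {s(0,1), s(1,2), s(2,3), s(3,4), s(4,5), s(5,6), s(6,7), s(7,0),
   s(1,3), s(3,5), s(5,7), s(1,7)}

/-- `L⁽²⁾`: obtained from `L⁽¹⁾` by deleting `w₁w₂, w₂w₈` and identifying `w₂`
with `w₈`.  Vertices `w₁, w, w₃, w₄, w₅, w₆, w₇` are `0, 1, 2, 3, 4, 5, 6`;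
`x = w₁ = 0`, `y = w₅ = 4`. -/
def L2 : SimpleGraph (Fin 7) := SimpleGraph.fromEdgeSet
  {s(0,1), s(1,2), s(2,3), s(3,4), s(4,5), s(5,6), s(6,1),
   s(1,3), s(3,5), s(5,1)}

/-- `L⁽³⁾`: obtained from `L⁽¹⁾` by adding a new vertex `w₉ = 8` and the edges
`w₄w₉, w₆w₉`; `x = w₁ = 0`, `y = w₅ = 4`. -/
def L3 : SimpleGraph (Fin 9) := SimpleGraph.fromEdgeSet
  {s(0,1), s(1,2), s(2,3), s(3,4), s(4,5), s(5,6), s(6,7), s(7,0),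
   s(1,3), s(3,5), s(5,7), s(1,7), s(3,8), s(5,8)}

/-- `L⁽⁴⁾`: the triangle `w₁w₂w₃w₁` together with pendant vertices `w₄, w₅`
and edges `w₁w₄, w₃w₅` (here `wᵢ = i - 1`); `x = w₄ = 3`, `y = w₅ = 4`. -/
def L4 : SimpleGraph (Fin 5) := SimpleGraph.fromEdgeSet
  {s(0,1), s(1,2), s(2,0), s(0,3), s(2,4)}

/-- A building block: a graph together with two distinguished vertices. -/
structure Block where
  V : Type
  G : SimpleGraph V
  x : V
  y : V

/-- The graph `G(L,x,y,l,m)` (allowing a different block for each of the `m`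
copies): disjoint copies `L₁, …, Lₘ` of the blocks, all possible edges between
pairs of vertices in `{x₁, …, xₘ, y₁, …, yₘ}`, joined with a complete graph
`T = Kₗ`. -/
def GGen {m : ℕ} (l : ℕ) (B : Fin m → Block) :
    SimpleGraph (Fin l ⊕ Σ i, (B i).V) :=
  SimpleGraph.fromRel fun a b =>
    (∃ t, a = Sum.inl t) ∨ (∃ t, b = Sum.inl t) ∨
    (∃ (i : Fin m) (u v : (B i).V),
      a = Sum.inr ⟨i, u⟩ ∧ b = Sum.inr ⟨i, v⟩ ∧ (B i).G.Adj u v) ∨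
    (∃ p q : Σ i, (B i).V, a = Sum.inr p ∧ b = Sum.inr q ∧
      (p.2 = (B p.1).x ∨ p.2 = (B p.1).y) ∧ (q.2 = (B q.1).x ∨ q.2 = (B q.1).y))

def blockL1 : Block := ⟨Fin 8, L1, 0, 4⟩
def blockL2 : Block := ⟨Fin 7, L2, 0, 4⟩
def blockL3 : Block := ⟨Fin 9, L3, 0, 4⟩
def blockL4 : Block := ⟨Fin 5, L4, 3, 4⟩

/-! ### Components of `GGen` from below: cutting blocks -/

/-- `B` has a cut of `p` vertices isolating `c` vertices different from `x` and `y`,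
and avoiding `x`. -/
def Block.HasCut (B : Block) (p c : ℕ) : Prop :=
  ∃ S R : Finset B.V, S.card = p ∧ R.card = c ∧ B.x ∉ S ∧ B.x ∉ R ∧ B.y ∉ R ∧
    ∀ r ∈ R, r ∉ S ∧ ∀ v, B.G.Adj r v → v ∈ S

/-- Deleting `S` from `B` costs at least `t` per component avoiding `x` and `y`, up to the
additive constant `α`. The set `R` contains a representative of each such component. -/
def Block.CutBound (B : Block) (t α : ℝ) : Prop :=
  ∀ S : Finset B.V, ∃ R : Finset B.V, (∀ v ∈ R, v ∉ S) ∧ α ≤ S.card - t * R.card ∧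
    ∀ Q : B.V → Prop, (∀ v ∈ R, Q v) → (B.x ∉ S → Q B.x) → (B.y ∉ S → Q B.y) →
      (∀ u v, Q u → u ∉ S → v ∉ S → B.G.Adj u v → Q v) → ∀ v, v ∉ S → Q v

section GGen

variable {m l : ℕ} {B : Fin m → Block}

lemma GGen_adj_inl {t : Fin l} {b : Fin l ⊕ Σ i, (B i).V} (h : Sum.inl t ≠ b) :
    (GGen l B).Adj (Sum.inl t) b :=
  (SimpleGraph.fromRel_adj _ _ _).2 ⟨h, Or.inl (Or.inl ⟨t, rfl⟩)⟩

lemma GGen_adj_block {i : Fin m} {u v : (B i).V} (h : (B i).G.Adj u v) :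
    (GGen l B).Adj (Sum.inr ⟨i, u⟩) (Sum.inr ⟨i, v⟩) := by
  refine (SimpleGraph.fromRel_adj _ _ _).2
    ⟨?_, Or.inl (Or.inr (Or.inr (Or.inl ⟨i, u, v, rfl, rfl, h⟩)))⟩
  intro he
  simp only [Sum.inr.injEq, Sigma.mk.injEq, heq_eq_eq, true_and] at he
  exact h.ne he

lemma GGen_adj_terminal {p q : Σ i, (B i).V} (hp : p.2 = (B p.1).x ∨ p.2 = (B p.1).y)
    (hq : q.2 = (B q.1).x ∨ q.2 = (B q.1).y) (h : p ≠ q) :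
    (GGen l B).Adj (Sum.inr p) (Sum.inr q) :=
  (SimpleGraph.fromRel_adj _ _ _).2
    ⟨fun he => h (Sum.inr_injective he),
      Or.inl (Or.inr (Or.inr (Or.inr ⟨p, q, rfl, rfl, hp, hq⟩)))⟩

/-- A vertex of a block other than `x`, `y` is adjacent only to `T` and to its neighbours
within the block. -/
lemma GGen_adj_inr {i : Fin m} {r : (B i).V} (hx : r ≠ (B i).x) (hy : r ≠ (B i).y)
    {b : Fin l ⊕ Σ i, (B i).V} (h : (GGen l B).Adj (Sum.inr ⟨i, r⟩) b) :
    (∃ t, b = Sum.inl t) ∨ ∃ v, b = Sum.inr ⟨i, v⟩ ∧ (B i).G.Adj r v := by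
  obtain ⟨-, (⟨t, ht⟩ | ⟨t, ht⟩ | ⟨j, u, v, h1, h2, h3⟩ | ⟨p, q, h1, h2, h3, h4⟩) |
    (⟨t, ht⟩ | ⟨t, ht⟩ | ⟨j, u, v, h1, h2, h3⟩ | ⟨p, q, h1, h2, h3, h4⟩)⟩ :=
    (SimpleGraph.fromRel_adj _ _ _).1 h
  · cases ht
  · exact Or.inl ⟨t, ht⟩
  · cases h1
    exact Or.inr ⟨v, h2, h3⟩
  · cases h1
    exact absurd h3 (by simp [hx, hy])
  · exact Or.inl ⟨t, ht⟩
  · cases ht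
  · cases h2
    exact Or.inr ⟨u, h1, h3.symm⟩
  · cases h2
    exact absurd h4 (by simp [hx, hy])

lemma exists_cut_GGen [∀ i, Finite (B i).V] {p c : Fin m → ℕ} (h : ∀ i, (B i).HasCut (p i) (c i))
    (i₀ : Fin m) : ∃ S : Finset (Fin l ⊕ Σ i, (B i).V),
      S.card = l + ∑ i, p i ∧ 1 + ∑ i, c i ≤ numComponents (GGen l B) ↑S := by
  classical
  choose S R hS hR hxS hxR hyR hiso using h
  let S' : Finset (Fin l ⊕ Σ i, (B i).V) :=
    (Finset.univ : Finset (Fin l)).disjSum (Finset.univ.sigma S)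
  refine ⟨S', ?_, ?_⟩
  · simp [S', Finset.card_disjSum, Finset.card_sigma, hS]
  let G' := (GGen l B).induce (S' : Set (Fin l ⊕ Σ i, (B i).V))ᶜ
  let g : ((S' : Set (Fin l ⊕ Σ i, (B i).V))ᶜ : Set _) → Option (Σ i, (B i).V) := fun v =>
    v.1.elim (fun _ => none) (fun q => if q.2 ∈ R q.1 then some q else none)
  have hno : ∀ u v : ((S' : Set (Fin l ⊕ Σ i, (B i).V))ᶜ : Set _), G'.Adj u v → g u = none := by
    rintro ⟨u | ⟨i, r⟩, hu⟩ ⟨v, hv⟩ huv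
    · rfl
    · by_cases hr : r ∈ R i
      · exfalso
        have hadj : (GGen l B).Adj (Sum.inr ⟨i, r⟩) v := huv
        rcases GGen_adj_inr (fun e => hxR i (e ▸ hr)) (fun e => hyR i (e ▸ hr)) hadj with
          ⟨t, rfl⟩ | ⟨w, rfl, hw⟩
        · exact hv (by simp [S'])
        · exact hv (by simpa [S'] using (hiso i r hr).2 w hw)
      · simp [g, hr]
  have hwalk : ∀ {u v} (_ : G'.Walk u v), g u = g v := by
    intro u v w
    induction w with
    | nil => rfl
    | cons hadj _ ih => rw [← ih, hno _ _ hadj, hno _ _ hadj.symm]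
  let f : G'.ConnectedComponent → Option (Σ i, (B i).V) :=
    SimpleGraph.ConnectedComponent.lift g (fun _ _ w _ => hwalk w)
  have : Finite G'.ConnectedComponent := Quot.finite _
  let _ := Fintype.ofFinite G'.ConnectedComponent
  have hsub : Finset.insertNone (Finset.univ.sigma R) ⊆ Finset.univ.image f := by
    intro o ho
    rw [Finset.mem_image]
    cases o with
    | none =>
      refine ⟨G'.connectedComponentMk ⟨Sum.inr ⟨i₀, (B i₀).x⟩, ?_⟩, Finset.mem_univ _, ?_⟩
      · simpa [S'] using hxS i₀
      · simp [f, g, hxR i₀]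
    | some q =>
      have hq : q.2 ∈ R q.1 := by simpa using ho
      refine ⟨G'.connectedComponentMk ⟨Sum.inr q, ?_⟩, Finset.mem_univ _, ?_⟩
      · simpa [S'] using (hiso q.1 q.2 hq).1
      · simp [f, g, hq]
  have := (Finset.card_le_card hsub).trans Finset.card_image_le
  rw [Finset.card_insertNone, Finset.card_sigma, Finset.card_univ,
    ← Nat.card_eq_fintype_card] at this
  simp only [hR] at this
  rw [add_comm]
  exact this

/-! ### Components of `GGen` from above -/

lemma inl_mem_of_one_lt_numComponents {S : Finset (Fin l ⊕ Σ i, (B i).V)}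
    (h : 1 < numComponents (GGen l B) ↑S) (t : Fin l) : Sum.inl t ∈ S := by
  by_contra ht
  have hreach : ∀ v, ((GGen l B).induce (S : Set (Fin l ⊕ Σ i, (B i).V))ᶜ).Reachable
      ⟨Sum.inl t, ht⟩ v := by
    intro v
    by_cases hv : Sum.inl t = v.1
    · rw [show v = ⟨Sum.inl t, ht⟩ from Subtype.ext hv.symm]
    · exact SimpleGraph.Adj.reachable (GGen_adj_inl hv)
  have : Subsingleton
      ((GGen l B).induce (S : Set (Fin l ⊕ Σ i, (B i).V))ᶜ).ConnectedComponent := by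
    refine ⟨fun a b => ?_⟩
    induction a using SimpleGraph.ConnectedComponent.ind with | _ a =>
    induction b using SimpleGraph.ConnectedComponent.ind with | _ b =>
    exact SimpleGraph.ConnectedComponent.sound ((hreach a).symm.trans (hreach b))
  have h1 : numComponents (GGen l B) ↑S ≤ 1 := Finite.card_le_one_iff_subsingleton.2 this
  omega

lemma numComponents_GGen_bound {t : ℝ} (ht : 0 ≤ t) {α : Fin m → ℝ}
    (hB : ∀ i, (B i).CutBound t (α i)) {S : Finset (Fin l ⊕ Σ i, (B i).V)}
    (h : 1 < numComponents (GGen l B) ↑S) :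
    t * numComponents (GGen l B) ↑S ≤ S.card + t - (l + ∑ i, α i) := by
  classical
  have hT := inl_mem_of_one_lt_numComponents h
  let S' : ∀ i, Finset (B i).V := fun i =>
    S.preimage (fun v => Sum.inr ⟨i, v⟩)
      (fun u _ v _ h => by simpa using h)
  have hS' : ∀ i v, v ∈ S' i ↔ Sum.inr ⟨i, v⟩ ∈ S := fun i v => Finset.mem_preimage
  choose R hRS hα hQ using fun i => hB i (S' i)
  have hcard : l + ∑ i, (S' i).card ≤ S.card := by
    have hsub : (Finset.univ : Finset (Fin l)).disjSum (Finset.univ.sigma S') ⊆ S := by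
      rintro (t | ⟨i, v⟩) hv
      · exact hT t
      · exact (hS' i v).1 (by simpa using hv)
    simpa [Finset.card_disjSum, Finset.card_sigma] using Finset.card_le_card hsub
  let G' := (GGen l B).induce (S : Set (Fin l ⊕ Σ i, (B i).V))ᶜ
  have hcomp : numComponents (GGen l B) ↑S ≤ 1 + ∑ i, (R i).card := by
    have hne : Nonempty G'.ConnectedComponent := by
      by_contra hne
      rw [not_nonempty_iff] at hne
      have : numComponents (GGen l B) ↑S = 0 := Nat.card_of_isEmpty
      omega
    have hterm : ∃ C₀ : G'.ConnectedComponent, ∀ (p : Σ i, (B i).V)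
        (_ : p.2 = (B p.1).x ∨ p.2 = (B p.1).y) (hp : Sum.inr p ∉ S),
        G'.connectedComponentMk ⟨Sum.inr p, hp⟩ = C₀ := by
      by_cases he : ∃ p : Σ i, (B i).V, (p.2 = (B p.1).x ∨ p.2 = (B p.1).y) ∧ Sum.inr p ∉ S
      · obtain ⟨q, hq, hqS⟩ := he
        refine ⟨G'.connectedComponentMk ⟨Sum.inr q, hqS⟩, fun p hp hpS => ?_⟩
        by_cases hpq : p = q
        · subst hpq; rfl
        · exact SimpleGraph.ConnectedComponent.sound
            (SimpleGraph.Adj.reachable (GGen_adj_terminal hp hq hpq))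
      · exact ⟨hne.some, fun p hp hpS => absurd ⟨p, hp, hpS⟩ he⟩
    obtain ⟨C₀, hC₀⟩ := hterm
    let f : Option (Σ i, R i) → G'.ConnectedComponent := fun o =>
      o.elim C₀ (fun q => G'.connectedComponentMk
        ⟨Sum.inr ⟨q.1, q.2.1⟩, fun hm => hRS q.1 q.2.1 q.2.2 ((hS' _ _).2 hm)⟩)
    have hf : Function.Surjective f := by
      intro C
      induction C using SimpleGraph.ConnectedComponent.ind with | _ v =>
      obtain ⟨t | ⟨i, v⟩, hv⟩ := v
      · exact absurd (hT t) hv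
      refine hQ i (fun w => ∀ hw : (Sum.inr ⟨i, w⟩ : Fin l ⊕ Σ i, (B i).V) ∉ S,
        ∃ o, f o = G'.connectedComponentMk ⟨Sum.inr ⟨i, w⟩, hw⟩) ?_ ?_ ?_ ?_ v
        (fun hm => hv ((hS' _ _).1 hm)) hv
      · intro w hw _
        exact ⟨some ⟨i, w, hw⟩, rfl⟩
      · intro _ hw
        exact ⟨none, (hC₀ ⟨i, _⟩ (Or.inl rfl) hw).symm⟩
      · intro _ hw
        exact ⟨none, (hC₀ ⟨i, _⟩ (Or.inr rfl) hw).symm⟩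
      · intro u w hu huS _ huw hw
        obtain ⟨o, ho⟩ := hu (fun hm => huS ((hS' _ _).2 hm))
        refine ⟨o, ho.trans (SimpleGraph.ConnectedComponent.sound
          (SimpleGraph.Adj.reachable (GGen_adj_block huw)))⟩
    have := Nat.card_le_card_of_surjective f hf
    rw [Finite.card_option, Nat.card_sigma] at this
    simp only [Nat.card_eq_fintype_card, Fintype.card_coe] at this
    rw [add_comm]
    exact this
  have hsum := Finset.sum_le_sum fun i (_ : i ∈ Finset.univ) => hα i
  rw [Finset.sum_sub_distrib, ← Finset.mul_sum] at hsum
  have hcard' : (l : ℝ) + ∑ i, ((S' i).card : ℝ) ≤ S.card := by exact_mod_cast hcard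
  have hcomp' : (numComponents (GGen l B) ↑S : ℝ) ≤ 1 + ∑ i, ((R i).card : ℝ) := by
    exact_mod_cast hcomp
  have := mul_le_mul_of_nonneg_left hcomp' ht
  linarith

end GGen

/-! ### Bounding the cuts of a block by computation on bit masks -/

namespace BitMask

/-- Adds to `a` the vertices outside `s` reached along the successive directed edges of a list. -/
def spread {n : ℕ} (s : ℕ) (E : List (Fin n × Fin n)) (a : ℕ) : ℕ :=
  E.foldl (fun a e => bif a.testBit e.1 && !s.testBit e.2 then a ||| 2 ^ (e.2 : ℕ) else a) a

/-- Number of elements below `k` of the set coded by `r`. -/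
def popcount (r : ℕ) : ℕ → ℕ
  | 0 => 0
  | k + 1 => popcount r k + bif r.testBit k then 1 else 0

/-- Adds greedily to `(r, a)` those of the first `k` vertices lying neither in `s` nor in `a`,
spreading `a` along `E` every time. -/
def reps {n : ℕ} (s : ℕ) (E : List (Fin n × Fin n)) (a : ℕ) : ℕ → ℕ × ℕ
  | 0 => (0, a)
  | k + 1 =>
    bif s.testBit k || (reps s E a k).2.testBit k then reps s E a k
    else ((reps s E a k).1 ||| 2 ^ k, spread s E ((reps s E a k).2 ||| 2 ^ k))

/-- Checks that `r` together with the mask `xy` reaches every vertex outside `s`. -/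
def covers (n : ℕ) (E : List (Fin n × Fin n)) (xy s r : ℕ) : Bool :=
  (spread s E ((r ||| xy) &&& ((2 ^ n - 1) ^^^ s)) ||| s) == 2 ^ n - 1

lemma popcount_eq (r n : ℕ) :
    popcount r n = (Finset.univ.filter fun i : Fin n => r.testBit i = true).card := by
  rw [Finset.card_filter, Fin.sum_univ_eq_sum_range (fun i => if r.testBit i = true then 1 else 0)]
  induction n with
  | zero => rfl
  | succ k ih =>
    rw [Finset.sum_range_succ, ← ih, popcount]
    cases r.testBit k <;> rfl

lemma spread_induction {n : ℕ} {s : ℕ} {Q : Fin n → Prop} {E : List (Fin n × Fin n)}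
    (hE : ∀ e ∈ E, Q e.1 → s.testBit e.1 = false → s.testBit e.2 = false → Q e.2) {a : ℕ}
    (ha : ∀ v : Fin n, a.testBit v = true → Q v ∧ s.testBit v = false) (v : Fin n)
    (hv : (spread s E a).testBit v = true) : Q v ∧ s.testBit v = false := by
  induction E generalizing a with
  | nil => exact ha v hv
  | cons e E ih =>
    refine ih (fun e' he' => hE e' (List.mem_cons_of_mem _ he')) ?_ hv
    intro w hw
    cases hc : (a.testBit e.1 && !s.testBit e.2) with
    | false => exact ha w (by simpa [hc] using hw)
    | true =>
      simp only [hc, cond_true, Nat.testBit_or, Nat.testBit_two_pow, Bool.or_eq_true,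
        decide_eq_true_eq] at hw
      rcases hw with hw | hw
      · exact ha w hw
      · obtain rfl : e.2 = w := Fin.ext hw
        simp only [Bool.and_eq_true, Bool.not_eq_true'] at hc
        obtain ⟨h1, h2⟩ := ha e.1 hc.1
        exact ⟨hE e (by simp) h1 h2 hc.2, hc.2⟩

lemma cutBound {n : ℕ} (G : SimpleGraph (Fin n)) (x y : Fin n) (E : List (Fin n × Fin n))
    (hE : ∀ e ∈ E, G.Adj e.1 e.2) (t α : ℝ) (ht : 0 ≤ t) (r : ℕ → ℕ)
    (hc : ∀ s < 2 ^ n, covers n E (2 ^ (x : ℕ) ||| 2 ^ (y : ℕ)) s (r s) = true)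
    (hα : ∀ s < 2 ^ n, α ≤ popcount s n - t * popcount (r s) n) :
    Block.CutBound ⟨Fin n, G, x, y⟩ t α := by
  classical
  intro (S : Finset (Fin n))
  let s := Nat.ofBits fun i : Fin n => decide (i ∈ S)
  have hs : s < 2 ^ n := Nat.ofBits_lt_two_pow _
  have hmem : ∀ v : Fin n, s.testBit v = true ↔ v ∈ S := fun v => by
    rw [Nat.testBit_ofBits_lt _ _ v.2]; simp
  have hmem' : ∀ v : Fin n, s.testBit v = false ↔ v ∉ S := fun v => by
    rw [← hmem, Bool.not_eq_true]
  let R := Finset.univ.filter fun v : Fin n => (r s).testBit v = true ∧ v ∉ S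
  have hSc : popcount s n = S.card := by
    rw [popcount_eq]; congr 1; ext v; simp [hmem]
  have hRc : R.card ≤ popcount (r s) n := by
    rw [popcount_eq]
    exact Finset.card_le_card fun v hv => by simp [R] at hv ⊢; exact hv.1
  refine ⟨R, fun v hv => (Finset.mem_filter.1 hv).2.2, ?_, ?_⟩
  · have h1 := hα s hs
    rw [hSc] at h1
    have h2 : (R.card : ℝ) ≤ popcount (r s) n := by exact_mod_cast hRc
    have := mul_le_mul_of_nonneg_left h2 ht
    change α ≤ (S.card : ℝ) - t * R.card
    linarith
  · intro Q hR hx hy hQ (v : Fin n) hv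
    have hcov := hc s hs
    rw [covers, beq_iff_eq] at hcov
    have hbit := congrArg (fun k => Nat.testBit k v) hcov
    simp only [Nat.testBit_or, Nat.testBit_two_pow_sub_one, (hmem' v).2 hv, Bool.or_false,
      v.2, decide_true] at hbit
    refine (spread_induction (Q := Q) (fun e he h1 h2 h3 =>
      hQ e.1 e.2 h1 ((hmem' _).1 h2) ((hmem' _).1 h3) (hE e he)) ?_ v hbit).1
    intro w hw
    simp only [Nat.testBit_and, Nat.testBit_or, Nat.testBit_xor, Nat.testBit_two_pow_sub_one,
      Nat.testBit_two_pow, w.2, decide_true, Bool.and_eq_true, Bool.or_eq_true,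
      decide_eq_true_eq, Bool.true_xor, Bool.not_eq_true'] at hw
    obtain ⟨hw1 | hw1 | hw1, hw2⟩ := hw
    · exact ⟨hR w (by simpa [R, hw1] using (hmem' w).1 hw2), hw2⟩
    · obtain rfl : x = w := Fin.ext hw1
      exact ⟨hx ((hmem' _).1 hw2), hw2⟩
    · obtain rfl : y = w := Fin.ext hw1
      exact ⟨hy ((hmem' _).1 hw2), hw2⟩

end BitMask

/-! ### The three blocks -/

/-- Both orientations of the listed edges, repeated so that spreading along the result reaches
whole components. -/
def orientations {n : ℕ} (D : List (Fin n × Fin n)) : List (Fin n × Fin n) :=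
  let E := D ++ D.map Prod.swap
  E ++ E ++ E ++ E

lemma adj_of_mem_orientations {n : ℕ} {G : SimpleGraph (Fin n)} {D : List (Fin n × Fin n)}
    (hD : ∀ e ∈ D, G.Adj e.1 e.2) : ∀ e ∈ orientations D, G.Adj e.1 e.2 := by
  intro e he
  simp only [orientations, List.mem_append, List.mem_map, or_self] at he
  rcases he with he | ⟨e', he', rfl⟩
  · exact hD e he
  · exact (hD e' he').symm

/-- The representatives used to bound the cuts of a block. -/
def blockReps {n : ℕ} (E : List (Fin n × Fin n)) (xy s : ℕ) : ℕ :=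
  (BitMask.reps s E (BitMask.spread s E (xy &&& ((2 ^ n - 1) ^^^ s))) n).1

def edgesL1 : List (Fin 8 × Fin 8) :=
  orientations [(0,1), (1,2), (2,3), (3,4), (4,5), (5,6), (6,7), (7,0),
   (1,3), (3,5), (5,7), (1,7)]

def edgesL2 : List (Fin 7 × Fin 7) :=
  orientations [(0,1), (1,2), (2,3), (3,4), (4,5), (5,6), (6,1), (1,3), (3,5), (5,1)]

def edgesL3 : List (Fin 9 × Fin 9) :=
  orientations [(0,1), (1,2), (2,3), (3,4), (4,5), (5,6), (6,7), (7,0),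
   (1,3), (3,5), (5,7), (1,7), (3,8), (5,8)]

lemma blockReps_L1 : ∀ s < 2 ^ 8, BitMask.covers 8 edgesL1 17 s (blockReps edgesL1 17 s) = true ∧
    2 * BitMask.popcount (blockReps edgesL1 17 s) 8 ≤ BitMask.popcount s 8 := by
  decide +kernel

lemma blockReps_L2 : ∀ s < 2 ^ 7, BitMask.covers 7 edgesL2 17 s (blockReps edgesL2 17 s) = true ∧
    3 * BitMask.popcount (blockReps edgesL2 17 s) 7 ≤ 2 * BitMask.popcount s 7 ∧
    2 * BitMask.popcount (blockReps edgesL2 17 s) 7 ≤ BitMask.popcount s 7 + 1 := by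
  decide +kernel

lemma blockReps_L3 : ∀ s < 2 ^ 9, BitMask.covers 9 edgesL3 17 s (blockReps edgesL3 17 s) = true ∧
    3 * BitMask.popcount (blockReps edgesL3 17 s) 9 ≤ 2 * BitMask.popcount s 9 + 1 ∧
    2 * BitMask.popcount (blockReps edgesL3 17 s) 9 ≤ BitMask.popcount s 9 + 2 := by
  decide +kernel

lemma cutBound_blockL1 {t : ℝ} (h0 : 0 ≤ t) (h2 : t ≤ 2) : blockL1.CutBound t 0 := by
  refine BitMask.cutBound L1 0 4 edgesL1 (adj_of_mem_orientations (by simp [L1])) t 0 h0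
    (blockReps edgesL1 17) (fun s hs => (blockReps_L1 s hs).1) fun s hs => ?_
  have h : (2 : ℝ) * BitMask.popcount (blockReps edgesL1 17 s) 8 ≤ BitMask.popcount s 8 := by
    exact_mod_cast (blockReps_L1 s hs).2
  have hc : (0 : ℝ) ≤ BitMask.popcount (blockReps edgesL1 17 s) 8 := Nat.cast_nonneg _
  nlinarith

lemma cutBound_blockL2 {t : ℝ} (h1 : 3 / 2 ≤ t) (h2 : t ≤ 2) : blockL2.CutBound t (3 - 2 * t) := by
  refine BitMask.cutBound L2 0 4 edgesL2 (adj_of_mem_orientations (by simp [L2])) t _ (by linarith)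
    (blockReps edgesL2 17) (fun s hs => (blockReps_L2 s hs).1) fun s hs => ?_
  obtain ⟨-, ha, hb⟩ := blockReps_L2 s hs
  have ha' : (3 : ℝ) * BitMask.popcount (blockReps edgesL2 17 s) 7 ≤
    2 * BitMask.popcount s 7 := by exact_mod_cast ha
  have hb' : (2 : ℝ) * BitMask.popcount (blockReps edgesL2 17 s) 7 ≤
    BitMask.popcount s 7 + 1 := by exact_mod_cast hb
  nlinarith [mul_nonneg (sub_nonneg.2 h2) (sub_nonneg.2 ha'),
    mul_nonneg (sub_nonneg.2 h1) (sub_nonneg.2 hb')]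

lemma cutBound_blockL3 {t : ℝ} (h1 : 3 / 2 ≤ t) (h2 : t ≤ 2) : blockL3.CutBound t (4 - 3 * t) := by
  refine BitMask.cutBound L3 0 4 edgesL3 (adj_of_mem_orientations (by simp [L3])) t _ (by linarith)
    (blockReps edgesL3 17) (fun s hs => (blockReps_L3 s hs).1) fun s hs => ?_
  obtain ⟨-, ha, hb⟩ := blockReps_L3 s hs
  have ha' : (3 : ℝ) * BitMask.popcount (blockReps edgesL3 17 s) 9 ≤
    2 * BitMask.popcount s 9 + 1 := by exact_mod_cast ha
  have hb' : (2 : ℝ) * BitMask.popcount (blockReps edgesL3 17 s) 9 ≤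
    BitMask.popcount s 9 + 2 := by exact_mod_cast hb
  nlinarith [mul_nonneg (sub_nonneg.2 h2) (sub_nonneg.2 ha'),
    mul_nonneg (sub_nonneg.2 h1) (sub_nonneg.2 hb')]

lemma hasCut_zero (B : Block) : B.HasCut 0 0 := ⟨∅, ∅, by simp⟩

lemma hasCut_of_isolated {n : ℕ} {G : SimpleGraph (Fin n)} {x y : Fin n} (S R : Finset (Fin n))
    (hxS : x ∉ S) (hxR : x ∉ R) (hyR : y ∉ R)
    (h : ∀ r ∈ R, r ∉ S ∧ ∀ v, G.Adj r v → v ∈ S) :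
    Block.HasCut ⟨Fin n, G, x, y⟩ S.card R.card :=
  ⟨S, R, rfl, rfl, hxS, hxR, hyR, h⟩

lemma hasCut_blockL2 : blockL2.HasCut 3 2 := by
  refine hasCut_of_isolated {1, 3, 5} {2, 6} (by decide) (by decide) (by decide) ?_
  simp only [L2, SimpleGraph.fromEdgeSet_adj, Set.mem_insert_iff, Set.mem_singleton_iff]
  decide

lemma hasCut_blockL3 : blockL3.HasCut 4 3 := by
  refine hasCut_of_isolated {1, 3, 5, 7} {2, 6, 8} (by decide) (by decide) (by decide) ?_
  simp only [L3, SimpleGraph.fromEdgeSet_adj, Set.mem_insert_iff, Set.mem_singleton_iff]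
  decide

lemma sum_last_mid {M : Type*} [AddCommMonoid M] (m₁ m₂ : ℕ) (hm : 1 ≤ m₁ + m₂) (a b : M) :
    ∑ i : Fin (m₁ + m₂), (if (i : ℕ) = m₁ + m₂ - 1 then a else if (i : ℕ) < m₁ then 0 else b) =
      (m₂ - 1) • b + a := by
  rw [Fin.sum_univ_eq_sum_range
    (fun i => if i = m₁ + m₂ - 1 then a else if i < m₁ then 0 else b)]
  obtain ⟨n, hn⟩ : ∃ n, m₁ + m₂ = n + 1 := ⟨m₁ + m₂ - 1, by omega⟩
  rw [hn, Finset.sum_range_succ, if_pos (Nat.add_sub_cancel n 1).symm]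
  congr 1
  have h1 : ∀ i ∈ Finset.range n, (if i = n + 1 - 1 then a else if i < m₁ then 0 else b) =
      if m₁ ≤ i then b else 0 := by
    intro i hi
    rw [Finset.mem_range] at hi
    rw [if_neg (by omega)]
    split_ifs <;> first | rfl | omega
  rw [Finset.sum_congr rfl h1, ← Finset.sum_filter, Finset.sum_const]
  have h2 : (Finset.range n).filter (fun i => m₁ ≤ i) = Finset.Ico m₁ n := by
    ext i; simp [and_comm]
  rw [h2, Nat.card_Ico]
  congr 1
  omega

/-- Claim 6: for `l ≥ 2`, `m = m₁ + m₂ ≥ 1` and `m₂ ≥ l - 2`, the graph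
`G‴` obtained from `G(L⁽¹⁾,x,y,l,m)` by replacing the copies `Lᵢ`,
`i = m₁+1, …, m-1`, with copies of `L⁽²⁾` and the copy `Lₘ` with a copy of
`L⁽³⁾` has toughness `(l + 3m₂ + 1)/(2(m₂ + 1))`. -/
theorem toughness_GGen_L1_L2_L3 (l m₁ m₂ : ℕ) (hl : 2 ≤ l) (hm : 1 ≤ m₁ + m₂)
    (hm₂ : l ≤ m₂ + 2) :
    HasToughness
      (GGen l (fun i : Fin (m₁ + m₂) =>
        if (i : ℕ) = m₁ + m₂ - 1 then blockL3
        else if (i : ℕ) < m₁ then blockL1 else blockL2))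
      (((l : ℝ) + 3 * m₂ + 1) / (2 * (m₂ + 1))) := by
  set B : Fin (m₁ + m₂) → Block := fun i =>
    if (i : ℕ) = m₁ + m₂ - 1 then blockL3 else if (i : ℕ) < m₁ then blockL1 else blockL2 with hB
  set t : ℝ := ((l : ℝ) + 3 * m₂ + 1) / (2 * (m₂ + 1)) with ht
  have hden : (0 : ℝ) < 2 * (m₂ + 1) := by positivity
  have htm : t * (2 * (m₂ + 1)) = l + 3 * m₂ + 1 := div_mul_cancel₀ _ hden.ne'
  have hl' : (2 : ℝ) ≤ l := by exact_mod_cast hl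
  have hm' : (l : ℝ) ≤ m₂ + 2 := by exact_mod_cast hm₂
  have ht1 : 3 / 2 ≤ t := by
    rw [ht, le_div_iff₀ hden]; linarith
  have ht2 : t ≤ 2 := by
    rw [ht, div_le_iff₀ hden]; linarith
  clear_value t
  have hpred : m₂ = 0 ∧ l = 2 ∨ ∃ k, m₂ = k + 1 := by
    cases m₂ with
    | zero => left; omega
    | succ k => exact Or.inr ⟨k, rfl⟩
  change HasToughness (GGen l B) t
  refine ⟨⟨by linarith, fun S hS => ?_⟩, ?_⟩
  · have hbound : ∀ i, (B i).CutBound t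
        (if (i : ℕ) = m₁ + m₂ - 1 then 4 - 3 * t else if (i : ℕ) < m₁ then 0 else 3 - 2 * t) := by
      intro i
      simp only [hB]
      split_ifs
      · exact cutBound_blockL3 ht1 ht2
      · exact cutBound_blockL1 (by linarith) ht2
      · exact cutBound_blockL2 ht1 ht2
    have hmain := numComponents_GGen_bound (by linarith) hbound hS
    rw [sum_last_mid m₁ m₂ hm, nsmul_eq_mul] at hmain
    rcases hpred with ⟨h0, h2⟩ | ⟨k, hk⟩
    · subst h0 h2
      norm_num at hmain htm
      obtain rfl : t = 3 / 2 := by linarith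
      linarith
    · subst hk
      push_cast [Nat.add_sub_cancel] at hmain htm
      nlinarith
  · rintro s ⟨hs0, hs⟩
    have hfin : ∀ i, Finite (B i).V := by
      intro i
      simp only [hB]
      split_ifs
      · exact inferInstanceAs (Finite (Fin 9))
      · exact inferInstanceAs (Finite (Fin 8))
      · exact inferInstanceAs (Finite (Fin 7))
    have hcut : ∀ i, (B i).HasCut
        (if (i : ℕ) = m₁ + m₂ - 1 then 4 else if (i : ℕ) < m₁ then 0 else 3)
        (if (i : ℕ) = m₁ + m₂ - 1 then 3 else if (i : ℕ) < m₁ then 0 else 2) := by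
      intro i
      simp only [hB]
      split_ifs
      · exact hasCut_blockL3
      · exact hasCut_zero _
      · exact hasCut_blockL2
    obtain ⟨S, hScard, hSnum⟩ := exists_cut_GGen (l := l) hcut ⟨0, by omega⟩
    rw [sum_last_mid m₁ m₂ hm, smul_eq_mul] at hScard hSnum
    have hle := hs S (by omega)
    rw [hScard] at hle
    have hSnum' : ((1 + ((m₂ - 1) * 2 + 3) : ℕ) : ℝ) ≤ numComponents (GGen l B) ↑S := by
      exact_mod_cast hSnum
    have hle' := (mul_le_mul_of_nonneg_left hSnum' hs0).trans hle
    rw [ht, le_div_iff₀ hden]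
    rcases hpred with ⟨h0, h2⟩ | ⟨k, hk⟩
    · subst h0 h2
      norm_num at hle' ⊢
      linarith
    · subst hk
      push_cast [Nat.add_sub_cancel] at hle' ⊢
      linarith
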